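/- For every positive integer n, every optimal set of n-points for P is contained in S_n; that is, if α ⊆ ⋃_{j=1}^n S_j with 1 ≤ card(α) ≤ n satisfies ∫ min_{a∈α} ‖y − a‖² dP(y) = V_n, then α ⊆ S_n. -/

import Mathlib

open MeasureTheory

noncomputable section

/-- The Euclidean plane ℝ². -/
abbrev Plane : Type := EuclideanSpace ℝ (Fin 2)

/-- The point (x, y) in the Euclidean plane. -/
def pt (x y : ℝ) : Plane := (WithLp.equiv 2 (Fin 2 → ℝ)).symm ![x, y]

/-- P: the uniform probability measure on the segment J = [0,1] × {0}, i.e. the pushforward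
of Lebesgue measure restricted to [0,1] under x ↦ (x, 0). -/
def P : Measure Plane :=
  Measure.map (fun x : ℝ => pt x 0) (volume.restrict (Set.Icc (0 : ℝ) 1))

/-- The constraint S_j = {(x, x + 1/j) : -1/j ≤ x ≤ 1}. -/
def S (j : ℕ) : Set Plane :=
  {p | ∃ x : ℝ, -(1 / (j : ℝ)) ≤ x ∧ x ≤ 1 ∧ p = pt x (x + 1 / (j : ℝ))}

/-- min_{b ∈ β} ‖y - b‖², written as an infimum over the image set. -/
def minDist (β : Set Plane) (y : Plane) : ℝ :=
  sInf ((fun b => ‖y - b‖ ^ 2) '' β)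

/-- The distortion error ∫ min_{b ∈ β} ‖y - b‖² dP(y) of a set β. -/
def distortion (β : Set Plane) : ℝ := ∫ y, minDist β y ∂P

/-- The n-th constrained quantization error for P with respect to the family (S_j). -/
def Vn (n : ℕ) : ℝ :=
  sInf {v : ℝ | ∃ α : Finset Plane,
    ↑α ⊆ (⋃ j ∈ Finset.Icc 1 n, S j) ∧ 1 ≤ α.card ∧ α.card ≤ n ∧ v = distortion ↑α}

/-- α is an optimal set of n-points for P: α ⊆ ⋃_{j=1}^n S_j, 1 ≤ card α ≤ n, and α attains the
n-th constrained quantization error. -/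
def IsOptimalNPoints (n : ℕ) (α : Finset Plane) : Prop :=
  ↑α ⊆ (⋃ j ∈ Finset.Icc 1 n, S j) ∧ 1 ≤ α.card ∧ α.card ≤ n ∧ distortion ↑α = Vn n

/-- The point of the line y = x + 1/n whose orthogonal projection line meets the first axis
at (m, 0). -/
def linePt (n : ℕ) (m : ℝ) : Plane := pt ((m - 1 / (n : ℝ)) / 2) ((m + 1 / (n : ℝ)) / 2)

/-- The abscissa in [0, 1] closest to the one at which the perpendicular through p to the line
y = x meets the first axis. -/
def foot (p : Plane) : ℝ := max 0 (min 1 (p 0 + p 1))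

lemma norm_sq_pt_sub (t : ℝ) (p : Plane) :
    ‖pt t 0 - p‖ ^ 2 = (t - (p 0 + p 1)) ^ 2 / 2 + (t + (p 1 - p 0)) ^ 2 / 2 := by
  rw [EuclideanSpace.norm_sq_eq, Fin.sum_univ_two]
  simp [pt]
  ring

lemma norm_sq_pt_sub_linePt (n : ℕ) (t m : ℝ) :
    ‖pt t 0 - linePt n m‖ ^ 2 = (t - m) ^ 2 / 2 + (t + 1 / (n : ℝ)) ^ 2 / 2 := by
  rw [norm_sq_pt_sub]
  simp [linePt, pt]
  ring

lemma linePt_mem_S (n : ℕ) {m : ℝ} (h0 : 0 ≤ m) (h1 : m ≤ 1) : linePt n m ∈ S n := by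
  have hn : 0 ≤ 1 / (n : ℝ) := by positivity
  refine ⟨(m - 1 / (n : ℝ)) / 2, by linarith, by linarith, ?_⟩
  rw [linePt]
  congr 1
  ring

lemma foot_nonneg (p : Plane) : 0 ≤ foot p := le_max_left _ _

lemma foot_le_one (p : Plane) : foot p ≤ 1 := max_le zero_le_one (min_le_left _ _)

lemma sq_sub_foot_le {t : ℝ} (h0 : 0 ≤ t) (h1 : t ≤ 1) (p : Plane) :
    (t - foot p) ^ 2 ≤ (t - (p 0 + p 1)) ^ 2 := by
  unfold foot
  rcases le_total (p 0 + p 1) 1 with h | h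
  · rw [min_eq_right h]
    rcases le_total (p 0 + p 1) 0 with h' | h'
    · rw [max_eq_left h']
      nlinarith
    · rw [max_eq_right h']
  · rw [min_eq_left h, max_eq_right zero_le_one]
    nlinarith

lemma mem_S_sub {j : ℕ} {p : Plane} (hp : p ∈ S j) : p 1 - p 0 = 1 / (j : ℝ) := by
  obtain ⟨x, -, -, rfl⟩ := hp
  simp [pt]

lemma norm_sq_linePt_foot_le {n j : ℕ} (hj : 1 ≤ j) (hjn : j ≤ n) {p : Plane} (hp : p ∈ S j)
    {t : ℝ} (h0 : 0 ≤ t) (h1 : t ≤ 1) :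
    ‖pt t 0 - linePt n (foot p)‖ ^ 2 ≤ ‖pt t 0 - p‖ ^ 2 := by
  rw [norm_sq_pt_sub_linePt, norm_sq_pt_sub, mem_S_sub hp]
  have hj' : (0 : ℝ) < j := by exact_mod_cast hj
  have hc : 1 / (n : ℝ) ≤ 1 / (j : ℝ) := one_div_le_one_div_of_le hj' (by exact_mod_cast hjn)
  have hn : 0 ≤ 1 / (n : ℝ) := by positivity
  have := sq_sub_foot_le h0 h1 p
  gcongr

lemma norm_sq_linePt_foot_lt {n j : ℕ} (hj : 1 ≤ j) (hjn : j < n) {p : Plane} (hp : p ∈ S j)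
    {t : ℝ} (h0 : 0 ≤ t) (h1 : t ≤ 1) :
    ‖pt t 0 - linePt n (foot p)‖ ^ 2 < ‖pt t 0 - p‖ ^ 2 := by
  rw [norm_sq_pt_sub_linePt, norm_sq_pt_sub, mem_S_sub hp]
  have hj' : (0 : ℝ) < j := by exact_mod_cast hj
  have hc : 1 / (n : ℝ) < 1 / (j : ℝ) := one_div_lt_one_div_of_lt hj' (by exact_mod_cast hjn)
  have hn : 0 ≤ 1 / (n : ℝ) := by positivity
  have := sq_sub_foot_le h0 h1 p
  have h2 : (t + 1 / (n : ℝ)) ^ 2 < (t + 1 / (j : ℝ)) ^ 2 := by gcongr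
  linarith

lemma minDist_eq_inf' {β : Finset Plane} (hβ : β.Nonempty) (y : Plane) :
    minDist ↑β y = β.inf' hβ (fun b => ‖y - b‖ ^ 2) := by
  rw [Finset.inf'_eq_csInf_image, minDist]

lemma minDist_le {β : Finset Plane} {b : Plane} (hb : b ∈ β) (y : Plane) :
    minDist ↑β y ≤ ‖y - b‖ ^ 2 := by
  rw [minDist_eq_inf' ⟨b, hb⟩]
  exact Finset.inf'_le _ hb

lemma exists_minDist_eq {β : Finset Plane} (hβ : β.Nonempty) (y : Plane) :
    ∃ b ∈ β, minDist ↑β y = ‖y - b‖ ^ 2 := by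
  rw [minDist_eq_inf' hβ]
  exact Finset.exists_mem_eq_inf' hβ _

lemma continuous_minDist {β : Finset Plane} (hβ : β.Nonempty) : Continuous (minDist ↑β) := by
  simp_rw [funext (minDist_eq_inf' hβ)]
  exact Continuous.finset_inf'_apply hβ fun b _ => by fun_prop

lemma continuous_pt_zero : Continuous fun t : ℝ => pt t 0 := by
  refine (PiLp.continuous_toLp 2 _).comp (continuous_pi fun i => ?_)
  fin_cases i
  · exact continuous_id
  · exact continuous_const

lemma distortion_eq {β : Finset Plane} (hβ : β.Nonempty) :
    distortion ↑β = ∫ t in (0 : ℝ)..1, minDist ↑β (pt t 0) := by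
  rw [distortion, P, integral_map continuous_pt_zero.aemeasurable
    (continuous_minDist hβ).aestronglyMeasurable, integral_Icc_eq_integral_Ioc,
    intervalIntegral.integral_of_le zero_le_one]

lemma distortion_nonneg (β : Set Plane) : 0 ≤ distortion β :=
  integral_nonneg fun y => Real.sInf_nonneg (by rintro _ ⟨b, -, rfl⟩; positivity)

lemma distortion_lt {α β : Finset Plane} (hα : α.Nonempty) (hβ : β.Nonempty)
    (hle : ∀ t ∈ Set.Icc (0 : ℝ) 1, minDist ↑β (pt t 0) ≤ minDist ↑α (pt t 0))
    (hlt : ∃ t ∈ Set.Icc (0 : ℝ) 1, minDist ↑β (pt t 0) < minDist ↑α (pt t 0)) :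
    distortion ↑β < distortion ↑α := by
  rw [distortion_eq hα, distortion_eq hβ]
  exact intervalIntegral.integral_lt_integral_of_continuousOn_of_le_of_exists_lt zero_lt_one
    ((continuous_minDist hβ).comp continuous_pt_zero).continuousOn
    ((continuous_minDist hα).comp continuous_pt_zero).continuousOn
    (fun t ht => hle t (Set.Ioc_subset_Icc_self ht)) hlt

lemma Vn_le {n : ℕ} (hn : 1 ≤ n) {β : Finset Plane} (hβ : β.Nonempty) (hS : ↑β ⊆ S n)
    (hcard : β.card ≤ n) : Vn n ≤ distortion ↑β := by
  refine csInf_le ⟨0, ?_⟩ ⟨β, fun p hp => ?_, hβ.card_pos, hcard, rfl⟩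
  · rintro _ ⟨γ, -, -, -, rfl⟩
    exact distortion_nonneg _
  · exact Set.mem_biUnion (Finset.mem_coe.2 (Finset.mem_Icc.2 ⟨hn, le_rfl⟩)) (hS hp)

/-- A competitor on S_n contradicts optimality as soon as it is pointwise no worse on J and
somewhere strictly better. -/
lemma IsOptimalNPoints.le_of_subset {n : ℕ} (hn : 1 ≤ n) {α β : Finset Plane}
    (h : IsOptimalNPoints n α) (hβ : β.Nonempty) (hS : ↑β ⊆ S n) (hcard : β.card ≤ n)
    (hle : ∀ t ∈ Set.Icc (0 : ℝ) 1, minDist ↑β (pt t 0) ≤ minDist ↑α (pt t 0)) :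
    ∀ t ∈ Set.Icc (0 : ℝ) 1, minDist ↑α (pt t 0) ≤ minDist ↑β (pt t 0) := by
  by_contra! hlt
  have h1 := distortion_lt (Finset.card_pos.1 h.2.1) hβ hle hlt
  rw [h.2.2.2] at h1
  exact (Vn_le hn hβ hS hcard).not_gt h1

/-- every optimal set of n-points for P is contained in S_n. -/
theorem optimal_subset_Sn (n : ℕ) (hn : 1 ≤ n) (α : Finset Plane)
    (h : IsOptimalNPoints n α) : ↑α ⊆ S n := by
  classical
  have hα : α.Nonempty := Finset.card_pos.1 h.2.1
  have hmem : ∀ p ∈ α, ∃ j, 1 ≤ j ∧ j ≤ n ∧ p ∈ S j := fun p hp => by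
    obtain ⟨j, hj, hpj⟩ := Set.mem_iUnion₂.1 (h.1 (Finset.mem_coe.2 hp))
    exact ⟨j, (Finset.mem_Icc.1 hj).1, (Finset.mem_Icc.1 hj).2, hpj⟩
  have hfoot : ∀ p ∈ α, ∀ t ∈ Set.Icc (0 : ℝ) 1,
      ‖pt t 0 - linePt n (foot p)‖ ^ 2 ≤ ‖pt t 0 - p‖ ^ 2 := fun p hp t ht => by
    obtain ⟨j, hj, hjn, hpj⟩ := hmem p hp
    exact norm_sq_linePt_foot_le hj hjn hpj ht.1 ht.2
  by_contra hsub
  obtain ⟨a, ha, haS⟩ := Set.not_subset.1 hsub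
  have ha : a ∈ α := ha
  have hge := h.le_of_subset hn (β := α.image fun p => linePt n (foot p)) (hα.image _)
    (by
      intro q hq
      obtain ⟨p, -, rfl⟩ := Finset.mem_image.1 (Finset.mem_coe.1 hq)
      exact linePt_mem_S n (foot_nonneg p) (foot_le_one p))
    (Finset.card_image_le.trans h.2.2.1)
    (fun t ht => by
      obtain ⟨p, hp, hpt⟩ := exists_minDist_eq hα (pt t 0)
      rw [hpt]
      exact (minDist_le (Finset.mem_image_of_mem _ hp) _).trans (hfoot p hp t ht))
  -- the point `a` is never a closest point of `α`
  have hne : ∀ t ∈ Set.Icc (0 : ℝ) 1, ∃ p ∈ α.erase a,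
      minDist ↑α (pt t 0) = ‖pt t 0 - p‖ ^ 2 := fun t ht => by
    obtain ⟨p, hp, hpt⟩ := exists_minDist_eq hα (pt t 0)
    refine ⟨p, Finset.mem_erase.2 ⟨?_, hp⟩, hpt⟩
    rintro rfl
    obtain ⟨j, hj, hjn, hpj⟩ := hmem p hp
    have hjn' : j < n := lt_of_le_of_ne hjn (by rintro rfl; exact haS hpj)
    have h1 := norm_sq_linePt_foot_lt hj hjn' hpj ht.1 ht.2
    have h2 := minDist_le (Finset.mem_image_of_mem (fun p => linePt n (foot p)) hp) (pt t 0)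
    have h3 := hge t ht
    linarith
  obtain ⟨s, hs, hsα⟩ := (Set.Icc_infinite (zero_lt_one (α := ℝ))).exists_notMem_finset
    (α.image foot)
  have hge' := h.le_of_subset hn
    (β := insert (linePt n s) ((α.erase a).image fun p => linePt n (foot p)))
    (Finset.insert_nonempty _ _)
    (by
      intro q hq
      rcases Finset.mem_insert.1 (Finset.mem_coe.1 hq) with rfl | hq
      · exact linePt_mem_S n hs.1 hs.2
      · obtain ⟨p, -, rfl⟩ := Finset.mem_image.1 hq
        exact linePt_mem_S n (foot_nonneg p) (foot_le_one p))
    ((Finset.card_insert_le _ _).trans <| by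
      have h1 : ((α.erase a).image fun p => linePt n (foot p)).card ≤ (α.erase a).card :=
        Finset.card_image_le
      have h2 := Finset.card_erase_add_one ha
      have h3 := h.2.2.1
      omega)
    (fun t ht => by
      obtain ⟨p, hp, hpt⟩ := hne t ht
      rw [hpt]
      exact (minDist_le (Finset.mem_insert_of_mem (Finset.mem_image_of_mem _ hp)) _).trans
        (hfoot p (Finset.mem_of_mem_erase hp) t ht))
    s hs
  obtain ⟨p, hp, hpt⟩ := hne s hs
  have hpα := Finset.mem_of_mem_erase hp
  have h1 := minDist_le
    (Finset.mem_insert_self (linePt n s) ((α.erase a).image fun p => linePt n (foot p))) (pt s 0)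
  have h2 := hfoot p hpα s hs
  rw [norm_sq_pt_sub_linePt] at h1 h2
  have h3 : 0 < (s - foot p) ^ 2 := by
    refine sq_pos_of_ne_zero (sub_ne_zero.2 ?_)
    rintro rfl
    exact hsα (Finset.mem_image_of_mem _ hpα)
  have h4 : (s - s) ^ 2 = 0 := by simp
  linarith

end
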